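/- Let n ≥ 3, m ≥ 1, and for each ε ∈ (0, 4/(n−2)) let u_ε be a radial Dirichlet solution with exactly m−1 interior zeros. Then for every a ∈ (0,1), sup over r ∈ [a,1] of | |u_ε(r)|·(κ_n ε)^{−1/2} − (n(n−2))^{(n−2)/4}·m^{1/2}·(r^{2−n} − 1) | → 0 as ε → 0⁺. In particular, u_ε converges uniformly to zero on [a,1] as ε → 0⁺. -/

import Mathlib

open Real Set Filter Topology MeasureTheory

noncomputable section

/-- `κ_n = ((n-2)/4) · Γ(n/2)² / Γ(n)`. -/
def kappa (n : ℕ) : ℝ :=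
  (((n : ℝ) - 2) / 4) * Real.Gamma ((n : ℝ) / 2) ^ 2 / Real.Gamma (n : ℝ)

/-- `p_ε = (n+2)/(n-2) - ε`. -/
def pEps (n : ℕ) (ε : ℝ) : ℝ := ((n : ℝ) + 2) / ((n : ℝ) - 2) - ε

/-- `u ∈ C²([0,1])` is a radial solution of `-Δu = |u|^{p-1} u` on the unit ball of `ℝⁿ`,
written in the radial variable: `(r^{n-1} u')' = -|u|^{p-1} u · r^{n-1}` on `(0,1]`,
with `u'(0) = 0`. -/
def IsRadialSolution (n : ℕ) (p : ℝ) (u : ℝ → ℝ) : Prop :=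
  ContDiffOn ℝ 2 u (Set.Icc 0 1) ∧ deriv u 0 = 0 ∧
    ∀ r ∈ Set.Ioc (0 : ℝ) 1,
      deriv (fun s => s ^ (n - 1) * deriv u s) r = -(|u r| ^ (p - 1) * u r * r ^ (n - 1))

/-- Radial Dirichlet solution with exactly `m-1` interior zeros, together with the
decreasing enumeration of its zeros `ρ 1 = 1 > ρ 2 > … > ρ m > 0` in `(0,1]` and of its
critical points `1 > δ 1 > … > δ m = 0` in `[0,1]`, interlaced as
`0 = δ m < ρ m < δ (m-1) < … < δ 1 < ρ 1 = 1`. -/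
def DirichletData (n : ℕ) (p : ℝ) (m : ℕ) (u : ℝ → ℝ) (ρ δ : ℕ → ℝ) : Prop :=
  IsRadialSolution n p u ∧ u 1 = 0 ∧ ρ 1 = 1 ∧ δ m = 0 ∧
    (∀ k, 1 ≤ k → k ≤ m → δ k < ρ k) ∧
    (∀ k, 1 ≤ k → k + 1 ≤ m → ρ (k + 1) < δ k) ∧
    {r : ℝ | r ∈ Set.Ioc (0 : ℝ) 1 ∧ u r = 0} = ρ '' Set.Icc 1 m ∧
    {r : ℝ | r ∈ Set.Icc (0 : ℝ) 1 ∧ deriv u r = 0} = δ '' Set.Icc 1 m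

/-- Radial Neumann solution with exactly `m-1` interior zeros, together with the
decreasing enumeration of its zeros `1 > ρ 1 > … > ρ (m-1) > 0` in `(0,1)` and of its
critical points `δ 1 = 1 > δ 2 > … > δ m = 0` in `[0,1]`, interlaced as
`0 = δ m < ρ (m-1) < δ (m-1) < … < ρ 1 < δ 1 = 1`. -/
def NeumannData (n : ℕ) (p : ℝ) (m : ℕ) (u : ℝ → ℝ) (ρ δ : ℕ → ℝ) : Prop :=
  IsRadialSolution n p u ∧ deriv u 1 = 0 ∧ δ 1 = 1 ∧ δ m = 0 ∧
    (∀ k, 1 ≤ k → k ≤ m - 1 → ρ k < δ k) ∧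
    (∀ k, 1 ≤ k → k ≤ m - 1 → δ (k + 1) < ρ k) ∧
    {r : ℝ | r ∈ Set.Ioo (0 : ℝ) 1 ∧ u r = 0} = ρ '' Set.Icc 1 (m - 1) ∧
    {r : ℝ | r ∈ Set.Icc (0 : ℝ) 1 ∧ deriv u r = 0} = δ '' Set.Icc 1 m

/-- A nontrivial radial Dirichlet solution with exactly `m-1` interior zeros. -/
def DirichletSol (n : ℕ) (p : ℝ) (m : ℕ) (u : ℝ → ℝ) : Prop :=
  IsRadialSolution n p u ∧ u 1 = 0 ∧ (∃ r ∈ Set.Icc (0 : ℝ) 1, u r ≠ 0) ∧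
    ∃ Z : Finset ℝ, (Z : Set ℝ) = {r | r ∈ Set.Ioo (0 : ℝ) 1 ∧ u r = 0} ∧ Z.card = m - 1

/-- A nontrivial radial Neumann solution with exactly `m-1` interior zeros. -/
def NeumannSol (n : ℕ) (p : ℝ) (m : ℕ) (u : ℝ → ℝ) : Prop :=
  IsRadialSolution n p u ∧ deriv u 1 = 0 ∧ (∃ r ∈ Set.Icc (0 : ℝ) 1, u r ≠ 0) ∧
    ∃ Z : Finset ℝ, (Z : Set ℝ) = {r | r ∈ Set.Ioo (0 : ℝ) 1 ∧ u r = 0} ∧ Z.card = m - 1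


/-! ### The Emden-Fowler system -/

/-- Twice the negative potential. -/
def gPot (γ p s : ℝ) : ℝ := γ * s ^ 2 - 2 * |s| ^ (p + 1) / (p + 1)

/-- Primitive of `sqrt (2η + g)`. -/
def hPrim (γ p η x : ℝ) : ℝ := ∫ s in (0 : ℝ)..x, √(2 * η + gPot γ p s)

structure EFSys (b γ p : ℝ) (V W : ℝ → ℝ) : Prop where
  hb : 0 < b
  hγ : 0 < γ
  hp : 1 < p
  cV : ContinuousOn V (Icc 0 1)
  cW : ContinuousOn W (Icc 0 1)
  V0 : V 0 = 0
  W0 : W 0 = 0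
  dV : ∀ r ∈ Ioo (0 : ℝ) 1, HasDerivAt V (W r / r) r
  dW : ∀ r ∈ Ioo (0 : ℝ) 1,
    HasDerivAt W ((b * W r + γ * V r - |V r| ^ (p - 1) * V r) / r) r
  fin : {r | r ∈ Ioo (0 : ℝ) 1 ∧ V r = 0}.Finite

def efE (γ p : ℝ) (V W : ℝ → ℝ) (r : ℝ) : ℝ := W r ^ 2 / 2 - gPot γ p (V r) / 2

lemma gPot_neg (γ p s : ℝ) : gPot γ p (-s) = gPot γ p s := by
  simp [gPot]

lemma gPot_zero (γ p : ℝ) (hp : 1 < p) : gPot γ p 0 = 0 := by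
  have : p + 1 ≠ 0 := by linarith
  simp [gPot, Real.zero_rpow this]

lemma gPot_hasDerivAt (γ p s : ℝ) (hp : 1 < p) :
    HasDerivAt (gPot γ p) (2 * (γ * s - |s| ^ (p - 1) * s)) s := by
  have h1 := hasDerivAt_abs_rpow s (p := p + 1) (by linarith)
  have h2 := ((hasDerivAt_pow 2 s).const_mul γ).sub ((h1.const_mul 2).div_const (p + 1))
  have hp' : p + 1 ≠ 0 := by linarith
  refine (h2.congr_deriv ?_)
  rw [show p + 1 - 2 = p - 1 by ring]
  field_simp
  push_cast
  ring

lemma gPot_continuous (γ p : ℝ) (hp : 1 < p) : Continuous (gPot γ p) :=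
  continuous_iff_continuousAt.2 fun s => (gPot_hasDerivAt γ p s hp).continuousAt

lemma hInt_continuous (γ p η : ℝ) (hp : 1 < p) :
    Continuous fun s => √(2 * η + gPot γ p s) :=
  (continuous_const.add (gPot_continuous γ p hp)).sqrt

lemma hPrim_hasDerivAt (γ p η x : ℝ) (hp : 1 < p) :
    HasDerivAt (hPrim γ p η) (√(2 * η + gPot γ p x)) x :=
  (hInt_continuous γ p η hp).integral_hasStrictDerivAt 0 x |>.hasDerivAt

lemma hPrim_continuous (γ p η : ℝ) (hp : 1 < p) : Continuous (hPrim γ p η) :=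
  continuous_iff_continuousAt.2 fun s => (hPrim_hasDerivAt γ p η s hp).continuousAt

lemma hPrim_mono (γ p η : ℝ) (hp : 1 < p) : Monotone (hPrim γ p η) :=
  monotone_of_deriv_nonneg (fun x => (hPrim_hasDerivAt γ p η x hp).differentiableAt)
    (fun x => by rw [(hPrim_hasDerivAt γ p η x hp).deriv]; positivity)

lemma hPrim_zero (γ p η : ℝ) : hPrim γ p η 0 = 0 := by simp [hPrim]

/-- If `g s < 0` and `0 < s ≤ t` then `g t ≤ 0`. -/
lemma gPot_nonpos_of_le (γ p s t : ℝ) (hp : 1 < p) (hs : 0 < s) (hst : s ≤ t)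
    (h : gPot γ p s < 0) : gPot γ p t ≤ 0 := by
  have ht : 0 < t := hs.trans_le hst
  have key : ∀ x : ℝ, 0 < x → gPot γ p x = x ^ 2 * (γ - 2 * x ^ (p - 1) / (p + 1)) := by
    intro x hx
    have : x ^ (p + 1) = x ^ 2 * x ^ (p - 1) := by
      rw [← Real.rpow_natCast, ← Real.rpow_add hx]; congr 1; push_cast; ring
    rw [gPot, abs_of_pos hx, this]; ring
  rw [key s hs] at h
  rw [key t ht]
  have h1 : γ - 2 * s ^ (p - 1) / (p + 1) < 0 := by
    by_contra hc
    push Not at hc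
    have := mul_nonneg (sq_nonneg s) hc
    linarith
  have h2 : s ^ (p - 1) ≤ t ^ (p - 1) := Real.rpow_le_rpow hs.le hst (by linarith)
  have h3 : 2 * s ^ (p - 1) / (p + 1) ≤ 2 * t ^ (p - 1) / (p + 1) := by
    apply div_le_div_of_nonneg_right _ (by linarith)
    linarith
  have : 0 ≤ t ^ 2 := by positivity
  nlinarith

lemma hPrim_eq_of_neg (γ p s t : ℝ) (hp : 1 < p) (hs : 0 < s) (hst : s ≤ t)
    (h : gPot γ p s < 0) : hPrim γ p 0 s = hPrim γ p 0 t := by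
  have hi := fun a b => (hInt_continuous γ p 0 hp).intervalIntegrable (μ := volume) a b
  have h1 : hPrim γ p 0 t - hPrim γ p 0 s = ∫ x in s..t, √(2 * 0 + gPot γ p x) := by
    unfold hPrim
    rw [intervalIntegral.integral_interval_sub_left (hi _ _) (hi _ _)]
  have h2 : ∫ x in s..t, √(2 * 0 + gPot γ p x) = ∫ x in s..t, (0 : ℝ) := by
    apply intervalIntegral.integral_congr
    intro x hx
    rw [uIcc_of_le hst] at hx
    have := gPot_nonpos_of_le γ p s x hp hs hx.1 h
    exact Real.sqrt_eq_zero_of_nonpos (by linarith)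
  rw [h2] at h1
  simp at h1
  linarith

namespace EFSys

variable {b γ p : ℝ} {V W : ℝ → ℝ}

lemma neg (S : EFSys b γ p V W) : EFSys b γ p (fun r => -V r) (fun r => -W r) where
  hb := S.hb
  hγ := S.hγ
  hp := S.hp
  cV := S.cV.neg
  cW := S.cW.neg
  V0 := by simp [S.V0]
  W0 := by simp [S.W0]
  dV := fun r hr => (S.dV r hr).neg.congr_deriv (by ring)
  dW := fun r hr => (S.dW r hr).neg.congr_deriv (by rw [abs_neg]; ring)
  fin := by simpa using S.fin

lemma efE_neg (r : ℝ) : efE γ p (fun r => -V r) (fun r => -W r) r = efE γ p V W r := by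
  simp [efE, gPot_neg]

lemma E_cont (S : EFSys b γ p V W) : ContinuousOn (efE γ p V W) (Icc 0 1) := by
  unfold efE
  exact ((S.cW.pow 2).div_const 2).sub
    (((gPot_continuous γ p S.hp).comp_continuousOn S.cV).div_const 2)

lemma E_deriv (S : EFSys b γ p V W) (r : ℝ) (hr : r ∈ Ioo (0 : ℝ) 1) :
    HasDerivAt (efE γ p V W) (b * W r ^ 2 / r) r := by
  have h1 := ((S.dW r hr).pow 2).div_const 2
  have h2 := ((gPot_hasDerivAt γ p (V r) S.hp).comp r (S.dV r hr)).div_const 2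
  refine (h1.sub h2).congr_deriv ?_
  have := hr.1.ne'
  field_simp
  push_cast
  ring

lemma E_mono (S : EFSys b γ p V W) : MonotoneOn (efE γ p V W) (Icc 0 1) := by
  apply monotoneOn_of_deriv_nonneg (convex_Icc 0 1) S.E_cont
  · rw [interior_Icc]
    exact fun r hr => (S.E_deriv r hr).differentiableAt.differentiableWithinAt
  · rw [interior_Icc]
    intro r hr
    rw [(S.E_deriv r hr).deriv]
    have := hr.1
    have := S.hb
    positivity

lemma E_zero (S : EFSys b γ p V W) : efE γ p V W 0 = 0 := by
  simp [efE, S.V0, S.W0, gPot_zero γ p S.hp]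

lemma E_nonneg (S : EFSys b γ p V W) {r : ℝ} (hr : r ∈ Icc (0 : ℝ) 1) :
    0 ≤ efE γ p V W r := by
  rw [← S.E_zero]
  exact S.E_mono ⟨le_rfl, zero_le_one⟩ hr hr.1

lemma E_pos (S : EFSys b γ p V W) {r : ℝ} (hr : r ∈ Ioc (0 : ℝ) 1) :
    0 < efE γ p V W r := by
  by_contra hc
  have hr' : r ∈ Icc (0 : ℝ) 1 := ⟨hr.1.le, hr.2⟩
  have hE : ∀ x ∈ Icc 0 r, efE γ p V W x = 0 := by
    intro x hx
    have hx1 : x ∈ Icc (0 : ℝ) 1 := ⟨hx.1, hx.2.trans hr.2⟩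
    have h1 := S.E_mono hx1 hr' hx.2
    have h2 := S.E_nonneg hx1
    linarith [not_lt.1 hc]
  have hW : ∀ x ∈ Ioo 0 r, W x = 0 := by
    intro x hx
    have hx1 : x ∈ Ioo (0 : ℝ) 1 := ⟨hx.1, hx.2.trans_le hr.2⟩
    have h1 := S.E_deriv x hx1
    have h2 : efE γ p V W =ᶠ[𝓝 x] fun _ => 0 := by
      filter_upwards [Ioo_mem_nhds hx.1 hx.2] with y hy using hE y ⟨hy.1.le, hy.2.le⟩
    have h3 := (h1.congr_of_eventuallyEq h2.symm).unique (hasDerivAt_const x 0)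
    have := S.hb.ne'
    have := hx.1.ne'
    rw [div_eq_zero_iff, mul_eq_zero] at h3
    simp_all
  have hV : ∀ x ∈ Icc 0 r, V x = 0 := by
    intro x hx
    by_contra hne
    rcases hx.1.eq_or_lt with h0 | h0
    · exact hne (h0 ▸ S.V0)
    obtain ⟨c, hc1, hc2⟩ := exists_hasDerivAt_eq_slope V (fun y => W y / y) h0
      (S.cV.mono (Icc_subset_Icc le_rfl (hx.2.trans hr.2)))
      (fun y hy => S.dV y ⟨hy.1, hy.2.trans_le (hx.2.trans hr.2)⟩)
    rw [hW c ⟨hc1.1, hc1.2.trans_le hx.2⟩, S.V0] at hc2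
    have := h0.ne'
    field_simp at hc2
    simp at hc2
    exact hne hc2.symm
  have : (Ioo 0 r).Infinite := Ioo_infinite hr.1
  exact this (S.fin.subset fun x hx => ⟨⟨hx.1, hx.2.trans_le hr.2⟩, hV x ⟨hx.1.le, hx.2.le⟩⟩)

/-- At an interior critical point with `V > 0`, `W' < 0`. -/
lemma crit (S : EFSys b γ p V W) {r : ℝ} (hr : r ∈ Ioo (0 : ℝ) 1) (hW : W r = 0)
    (hV : 0 < V r) : (b * W r + γ * V r - |V r| ^ (p - 1) * V r) / r < 0 := by
  have hE := S.E_pos ⟨hr.1, hr.2.le⟩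
  rw [efE, hW, gPot, abs_of_pos hV] at hE
  have hp := S.hp
  have e : V r ^ (p + 1) = V r ^ 2 * V r ^ (p - 1) := by
    rw [← Real.rpow_natCast, ← Real.rpow_add hV]; congr 1; push_cast; ring
  rw [e] at hE
  have hp1 : 0 < p + 1 := by linarith
  have h1 : 0 < V r ^ 2 * (2 * V r ^ (p - 1) / (p + 1) - γ) := by
    have : V r ^ 2 * (2 * V r ^ (p - 1) / (p + 1) - γ) =
      2 * (0 ^ 2 / 2 - (γ * V r ^ 2 - 2 * (V r ^ 2 * V r ^ (p - 1)) / (p + 1)) / 2) := by ring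
    rw [this]; linarith
  have h2 : 0 < 2 * V r ^ (p - 1) / (p + 1) - γ := by
    rcases pos_and_pos_or_neg_and_neg_of_mul_pos h1 with h | h
    · exact h.2
    · exact absurd h.1 (not_lt.2 (sq_nonneg _))
  have h3 : 2 * V r ^ (p - 1) / (p + 1) ≤ V r ^ (p - 1) := by
    rw [div_le_iff₀ hp1]
    have : 0 < V r ^ (p - 1) := Real.rpow_pos_of_pos hV _
    nlinarith
  rw [hW, abs_of_pos hV]
  apply div_neg_of_neg_of_pos _ hr.1
  nlinarith

end EFSys

namespace EFSys

variable {b γ p : ℝ} {V W : ℝ → ℝ}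

lemma W_sq (r : ℝ) : W r ^ 2 = 2 * efE γ p V W r + gPot γ p (V r) := by
  unfold efE; ring

/-- derivative of `E + k b H(V)`. -/
lemma comb_deriv (S : EFSys b γ p V W) (k η : ℝ) {r : ℝ} (hr : r ∈ Ioo (0 : ℝ) 1) :
    HasDerivAt (fun r => efE γ p V W r + k * b * hPrim γ p η (V r))
      (b / r * (W r * (W r + k * √(2 * η + gPot γ p (V r))))) r := by
  have h1 := (hPrim_hasDerivAt γ p η (V r) S.hp).comp r (S.dV r hr)
  refine ((S.E_deriv r hr).add (h1.const_mul (k * b))).congr_deriv ?_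
  ring

lemma comb_cont (S : EFSys b γ p V W) (k η : ℝ) :
    ContinuousOn (fun r => efE γ p V W r + k * b * hPrim γ p η (V r)) (Icc 0 1) :=
  S.E_cont.add (((hPrim_continuous γ p η S.hp).comp_continuousOn S.cV).const_smul (k * b))

lemma comb_mono (S : EFSys b γ p V W) (k η : ℝ) {s t : ℝ} (hs : 0 ≤ s) (hst : s ≤ t) (ht : t ≤ 1)
    (h : ∀ r ∈ Ioo s t, 0 ≤ W r * (W r + k * √(2 * η + gPot γ p (V r)))) :
    efE γ p V W s + k * b * hPrim γ p η (V s) ≤ efE γ p V W t + k * b * hPrim γ p η (V t) := by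
  have hsub : Ioo s t ⊆ Ioo 0 1 := Ioo_subset_Ioo hs ht
  have : MonotoneOn (fun r => efE γ p V W r + k * b * hPrim γ p η (V r)) (Icc s t) := by
    apply monotoneOn_of_deriv_nonneg (convex_Icc s t)
      ((S.comb_cont k η).mono (Icc_subset_Icc hs ht))
    · rw [interior_Icc]
      exact fun r hr => (S.comb_deriv k η (hsub hr)).differentiableAt.differentiableWithinAt
    · rw [interior_Icc]
      intro r hr
      rw [(S.comb_deriv k η (hsub hr)).deriv]
      exact mul_nonneg (div_nonneg S.hb.le (hsub hr).1.le) (h r hr)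
  exact this ⟨le_rfl, hst⟩ ⟨hst, le_rfl⟩ hst

lemma comb_anti (S : EFSys b γ p V W) (k η : ℝ) {s t : ℝ} (hs : 0 ≤ s) (hst : s ≤ t) (ht : t ≤ 1)
    (h : ∀ r ∈ Ioo s t, W r * (W r + k * √(2 * η + gPot γ p (V r))) ≤ 0) :
    efE γ p V W t + k * b * hPrim γ p η (V t) ≤ efE γ p V W s + k * b * hPrim γ p η (V s) := by
  have hsub : Ioo s t ⊆ Ioo 0 1 := Ioo_subset_Ioo hs ht
  have : AntitoneOn (fun r => efE γ p V W r + k * b * hPrim γ p η (V r)) (Icc s t) := by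
    apply antitoneOn_of_deriv_nonpos (convex_Icc s t)
      ((S.comb_cont k η).mono (Icc_subset_Icc hs ht))
    · rw [interior_Icc]
      exact fun r hr => (S.comb_deriv k η (hsub hr)).differentiableAt.differentiableWithinAt
    · rw [interior_Icc]
      intro r hr
      rw [(S.comb_deriv k η (hsub hr)).deriv]
      exact mul_nonpos_of_nonneg_of_nonpos (div_nonneg S.hb.le (hsub hr).1.le) (h r hr)
  exact this ⟨le_rfl, hst⟩ ⟨hst, le_rfl⟩ hst

lemma sqrt_le_absW (S : EFSys b γ p V W) {r : ℝ} (hr : r ∈ Icc (0 : ℝ) 1) :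
    √(2 * 0 + gPot γ p (V r)) ≤ |W r| := by
  apply Real.sqrt_le_iff.2 ⟨abs_nonneg _, _⟩
  rw [sq_abs, W_sq (γ := γ) (p := p) (V := V)]
  linarith [S.E_nonneg hr]

lemma absW_le_sqrt {r η : ℝ} (h : efE γ p V W r ≤ η) :
    |W r| ≤ √(2 * η + gPot γ p (V r)) := by
  apply Real.le_sqrt_of_sq_le
  rw [sq_abs, W_sq (γ := γ) (p := p) (V := V)]
  linarith

lemma nodal_pos (S : EFSys b γ p V W) {x y R η : ℝ} (hx : 0 ≤ x) (hxy : x < y) (hy : y ≤ 1)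
    (Vx : V x = 0) (Vy : V y = 0) (pos : ∀ r ∈ Ioo x y, 0 < V r) (hη : 0 ≤ η)
    (hR : ∀ s, R < s → 2 * η + gPot γ p s < 0) :
    efE γ p V W x + 2 * b * hPrim γ p 0 R ≤ efE γ p V W y ∧
    ∀ t ∈ Icc x y, efE γ p V W t ≤ η → efE γ p V W t ≤ efE γ p V W x + 2 * b * hPrim γ p η R := by
  have hsub : Ioo x y ⊆ Ioo 0 1 := Ioo_subset_Ioo hx hy
  have hsub' : Icc x y ⊆ Icc 0 1 := Icc_subset_Icc hx hy
  obtain ⟨c, hc, hWc⟩ := exists_hasDerivAt_eq_zero hxy (S.cV.mono hsub') (by rw [Vx, Vy])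
    (fun r hr => S.dV r (hsub hr))
  have hc01 := hsub hc
  have Wc : W c = 0 := by
    rcases div_eq_zero_iff.1 hWc with h | h
    · exact h
    · exact absurd h hc01.1.ne'
  have Wneg : ∀ r ∈ Ioo c y, W r ≤ 0 := by
    intro r hr
    have hsub2 : Ico c r ⊆ Ioo x y := fun z hz => ⟨hc.1.trans_le hz.1, hz.2.trans hr.2⟩
    refine image_le_of_deriv_right_lt_deriv_boundary (f := W) (a := c) (b := r)
      (B := fun _ => 0) (B' := fun _ => 0) (S.cW.mono ?_)
      (fun z hz => (S.dW z (hsub (hsub2 hz))).hasDerivWithinAt) Wc.le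
      (fun z => hasDerivAt_const z 0) (fun z hz hz0 => ?_) (x := r) ⟨hr.1.le, le_rfl⟩
    · exact fun z hz => ⟨hc01.1.le.trans hz.1, (hz.2.trans hr.2.le).trans hy⟩
    · exact S.crit (hsub (hsub2 hz)) hz0 (pos z (hsub2 hz))
  have Wpos : ∀ r ∈ Ioo x c, 0 ≤ W r := by
    intro r hr
    have hsub2 : Ioc r c ⊆ Ioo x y := fun z hz => ⟨hr.1.trans hz.1, hz.2.trans_lt hc.2⟩
    have := image_le_of_deriv_right_lt_deriv_boundary (f := fun z => -W (-z)) (a := -c) (b := -r)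
      (f' := fun z => (b * W (-z) + γ * V (-z) - |V (-z)| ^ (p - 1) * V (-z)) / (-z))
      (B := fun _ => 0) (B' := fun _ => 0) ?_
      (fun z hz => ?_) (by simp [Wc])
      (fun z => hasDerivAt_const z 0) (fun z hz hz0 => ?_) (x := -r) ⟨by linarith [hr.2], le_rfl⟩
    · simpa using this
    · apply ContinuousOn.neg
      apply S.cW.comp continuousOn_neg
      intro z hz
      constructor <;> linarith [hz.1, hz.2, hc01.2, hr.1]
    · have hz' : -z ∈ Ioc r c := ⟨by linarith [hz.2], by linarith [hz.1]⟩
      have h := ((S.dW (-z) (hsub (hsub2 hz'))).scomp z (hasDerivAt_neg z)).neg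
      exact (h.congr_deriv (by simp)).hasDerivWithinAt
    · have hz' : -z ∈ Ioc r c := ⟨by linarith [hz.2], by linarith [hz.1]⟩
      exact S.crit (hsub (hsub2 hz')) (by simpa using hz0) (pos _ (hsub2 hz'))
  have hcV := pos c hc
  have hcI : c ∈ Icc (0 : ℝ) 1 := ⟨hc01.1.le, hc01.2.le⟩
  have hb := S.hb
  constructor
  · have h1 := S.comb_mono (-1) 0 hx hc.1.le hc01.2.le (fun r hr => by
      have h := S.sqrt_le_absW (r := r) ⟨hx.trans hr.1.le, hr.2.le.trans hc01.2.le⟩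
      rw [abs_of_nonneg (Wpos r hr)] at h
      exact mul_nonneg (Wpos r hr) (by linarith))
    have h2 := S.comb_mono 1 0 hc01.1.le hc.2.le hy (fun r hr => by
      have h := S.sqrt_le_absW (r := r) ⟨hcI.1.trans hr.1.le, hr.2.le.trans hy⟩
      rw [abs_of_nonpos (Wneg r hr)] at h
      exact mul_nonneg_of_nonpos_of_nonpos (Wneg r hr) (by linarith))
    rw [Vx, hPrim_zero] at h1
    rw [Vy, hPrim_zero] at h2
    have hg : gPot γ p (V c) < 0 := by
      have h := S.E_pos ⟨hc01.1, hc01.2.le⟩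
      rw [efE, Wc] at h
      linarith
    have h3 := hPrim_eq_of_neg γ p (V c) (max R (V c)) S.hp hcV (le_max_right _ _) hg
    have h4 := hPrim_mono γ p 0 S.hp (le_max_left R (V c))
    rw [← h3] at h4
    have := mul_le_mul_of_nonneg_left h4 hb.le
    linarith
  · intro t ht hEt
    have hVR : ∀ r ∈ Icc x t, V r ≤ R := by
      intro r hr
      by_contra hc
      have h1 := hR _ (not_le.1 hc)
      have h2 := W_sq (γ := γ) (p := p) (V := V) (W := W) r
      have h3 := S.E_mono (hsub' ⟨hr.1, hr.2.trans ht.2⟩) (hsub' ht) hr.2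
      have := sq_nonneg (W r)
      linarith
    have hV0 : ∀ r ∈ Icc x y, 0 ≤ V r := by
      intro r hr
      rcases hr.1.eq_or_lt with h | h
      · rw [← h, Vx]
      rcases hr.2.eq_or_lt with h' | h'
      · rw [h', Vy]
      exact (pos r ⟨h, h'⟩).le
    have hH0 : ∀ r ∈ Icc x t, 0 ≤ hPrim γ p η (V r) := by
      intro r hr
      rw [← hPrim_zero γ p η]
      exact hPrim_mono γ p η S.hp (hV0 r ⟨hr.1, hr.2.trans ht.2⟩)
    have hHR : ∀ r ∈ Icc x t, b * hPrim γ p η (V r) ≤ b * hPrim γ p η R := by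
      intro r hr
      exact mul_le_mul_of_nonneg_left (hPrim_mono γ p η S.hp (hVR r hr)) hb.le
    have hEr : ∀ r ∈ Icc x t, efE γ p V W r ≤ η := fun r hr =>
      (S.E_mono (hsub' ⟨hr.1, hr.2.trans ht.2⟩) (hsub' ht) hr.2).trans hEt
    have up : ∀ s, x ≤ s → s ≤ t → s ≤ c →
        efE γ p V W s ≤ efE γ p V W x + b * hPrim γ p η (V s) := by
      intro s hs hst hsc
      have h1 := S.comb_anti (-1) η hx hs (hsc.trans hcI.2) (fun r hr => by
        have h := absW_le_sqrt (hEr r ⟨hr.1.le, hr.2.le.trans hst⟩)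
        rw [abs_of_nonneg (Wpos r ⟨hr.1, hr.2.trans_le hsc⟩)] at h
        exact mul_nonpos_of_nonneg_of_nonpos (Wpos r ⟨hr.1, hr.2.trans_le hsc⟩) (by linarith))
      rw [Vx, hPrim_zero] at h1
      linarith
    rcases le_total t c with htc | htc
    · have h1 := up t ht.1 le_rfl htc
      have h2 := hHR t ⟨ht.1, le_rfl⟩
      have h3 := mul_nonneg hb.le (hH0 t ⟨ht.1, le_rfl⟩)
      linarith
    · have h1 := up c hc.1.le htc le_rfl
      have h2 := S.comb_anti 1 η hcI.1 htc (ht.2.trans hy) (fun r hr => by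
        have h := absW_le_sqrt (hEr r ⟨hc.1.le.trans hr.1.le, hr.2.le⟩)
        have hw := Wneg r ⟨hr.1, hr.2.trans_le ht.2⟩
        rw [abs_of_nonpos hw] at h
        exact mul_nonpos_of_nonpos_of_nonneg hw (by linarith))
      have h3 := hHR c ⟨hc.1.le, htc⟩
      have h4 := mul_nonneg hb.le (hH0 t ⟨ht.1, le_rfl⟩)
      linarith

lemma nodal (S : EFSys b γ p V W) {x y R η : ℝ} (hx : 0 ≤ x) (hxy : x < y) (hy : y ≤ 1)
    (Vx : V x = 0) (Vy : V y = 0) (hne : ∀ r ∈ Ioo x y, V r ≠ 0) (hη : 0 ≤ η)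
    (hR : ∀ s, R < s → 2 * η + gPot γ p s < 0) :
    efE γ p V W x + 2 * b * hPrim γ p 0 R ≤ efE γ p V W y ∧
    ∀ t ∈ Icc x y, efE γ p V W t ≤ η → efE γ p V W t ≤ efE γ p V W x + 2 * b * hPrim γ p η R := by
  have hcont : ContinuousOn V (Ioo x y) :=
    S.cV.mono (Ioo_subset_Icc_self.trans (Icc_subset_Icc hx hy))
  have hpc : IsPreconnected (Ioo x y) := isPreconnected_Ioo
  by_cases hpos : ∀ r ∈ Ioo x y, 0 < V r
  · exact S.nodal_pos hx hxy hy Vx Vy hpos hη hR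
  · push Not at hpos
    obtain ⟨r0, hr0, hV0⟩ := hpos
    have hneg : ∀ r ∈ Ioo x y, 0 < -V r := by
      intro r hr
      by_contra hc
      have : (0 : ℝ) ∈ V '' Ioo x y :=
        hpc.intermediate_value hr0 hr hcont ⟨hV0, by linarith⟩
      obtain ⟨z, hz, hz0⟩ := this
      exact hne z hz hz0
    have := S.neg.nodal_pos hx hxy hy (by simp [Vx]) (by simp [Vy]) hneg hη hR
    simpa only [efE_neg] using this

lemma count (S : EFSys b γ p V W) {R η : ℝ} (hη : 0 ≤ η)
    (hR : ∀ s, R < s → 2 * η + gPot γ p s < 0) (k : ℕ) :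
    ∀ y ∈ Ioc (0 : ℝ) 1, V y = 0 → ∀ Z : Finset ℝ,
      (Z : Set ℝ) = {r | r ∈ Ioo (0 : ℝ) y ∧ V r = 0} → Z.card = k →
      2 * b * (k + 1) * hPrim γ p 0 R ≤ efE γ p V W y ∧
      ∀ t ∈ Icc 0 y, efE γ p V W t ≤ η → efE γ p V W t ≤ 2 * b * (k + 1) * hPrim γ p η R := by
  induction k with
  | zero =>
    intro y hy Vy Z hZ hk
    have hZ0 : Z = ∅ := Finset.card_eq_zero.1 hk
    have hne : ∀ r ∈ Ioo 0 y, V r ≠ 0 := by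
      intro r hr h0
      have : r ∈ (Z : Set ℝ) := by rw [hZ]; exact ⟨hr, h0⟩
      simp [hZ0] at this
    have := S.nodal le_rfl hy.1 hy.2 S.V0 Vy hne hη hR
    rw [S.E_zero] at this
    simpa using this
  | succ k ih =>
    intro y hy Vy Z hZ hk
    have hZne : Z.Nonempty := by rw [← Finset.card_pos]; omega
    set x := Z.max' hZne with hxdef
    have hxZ : x ∈ Z := Z.max'_mem hZne
    have hmem : ∀ r, r ∈ Z ↔ r ∈ Ioo 0 y ∧ V r = 0 := by
      intro r
      rw [← Finset.mem_coe, hZ]; rfl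
    have hx := (hmem x).1 hxZ
    have hne : ∀ r ∈ Ioo x y, V r ≠ 0 := by
      intro r hr h0
      have : r ∈ Z := (hmem r).2 ⟨⟨hx.1.1.trans hr.1, hr.2⟩, h0⟩
      exact absurd (Z.le_max' r this) (not_le.2 hr.1)
    have hN := S.nodal hx.1.1.le hx.1.2 hy.2 hx.2 Vy hne hη hR
    have hI := ih x ⟨hx.1.1, hx.1.2.le.trans hy.2⟩ hx.2 (Z.erase x) (by
      ext r
      simp only [Finset.coe_erase, Set.mem_sdiff, Finset.mem_coe, hmem, Set.mem_singleton_iff,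
        Set.mem_ofPred_eq]
      constructor
      · rintro ⟨⟨h1, h2⟩, h3⟩
        have : r ≤ x := Z.le_max' r ((hmem r).2 ⟨h1, h2⟩)
        exact ⟨⟨h1.1, lt_of_le_of_ne this h3⟩, h2⟩
      · rintro ⟨h1, h2⟩
        exact ⟨⟨⟨h1.1, h1.2.trans hx.1.2⟩, h2⟩, h1.2.ne⟩)
      (by rw [Finset.card_erase_of_mem hxZ, hk]; rfl)
    push_cast
    constructor
    · linarith [hI.1, hN.1]
    · intro t ht hEt
      have hH : 0 ≤ hPrim γ p η R := by
        by_contra hc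
        have hR0 : R < 0 := by
          by_contra h'
          apply hc
          rw [← hPrim_zero γ p η]
          exact hPrim_mono γ p η S.hp (not_lt.1 h')
        have := hR 0 hR0
        rw [gPot_zero γ p S.hp] at this
        linarith
      rcases le_total t x with htx | htx
      · have h1 := hI.2 t ⟨ht.1, htx⟩ hEt
        have := mul_nonneg S.hb.le hH
        linarith
      · have h1 := hN.2 t ⟨htx, ht.2⟩ hEt
        have h2 := S.E_mono ⟨hx.1.1.le, hx.1.2.le.trans hy.2⟩ ⟨ht.1, ht.2.trans hy.2⟩ htx
        have h3 := hI.2 x ⟨hx.1.1.le, le_rfl⟩ (h2.trans hEt)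
        linarith

/-- Two-sided energy bound at `r = 1`. -/
lemma energy (S : EFSys b γ p V W) {R η : ℝ} (hη : 0 ≤ η)
    (hR : ∀ s, R < s → 2 * η + gPot γ p s < 0) (m : ℕ) (hm : 1 ≤ m) (V1 : V 1 = 0)
    (Z : Finset ℝ) (hZ : (Z : Set ℝ) = {r | r ∈ Ioo (0 : ℝ) 1 ∧ V r = 0})
    (hk : Z.card = m - 1) (hsmall : 2 * b * m * hPrim γ p η R < η) :
    2 * b * m * hPrim γ p 0 R ≤ efE γ p V W 1 ∧
      efE γ p V W 1 ≤ 2 * b * m * hPrim γ p η R := by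
  have h := S.count hη hR (m - 1) 1 ⟨one_pos, le_rfl⟩ V1 Z hZ hk
  have e : (((m - 1 : ℕ) : ℝ) + 1) = m := by
    rw [Nat.cast_sub hm]; simp
  rw [e] at h
  refine ⟨h.1, h.2 1 ⟨zero_le_one, le_rfl⟩ ?_⟩
  by_contra hc
  have : η ∈ efE γ p V W '' Icc 0 1 :=
    intermediate_value_Icc zero_le_one S.E_cont ⟨by rw [S.E_zero]; exact hη, (not_le.1 hc).le⟩
  obtain ⟨t, ht, hEt⟩ := this
  have := h.2 t ht hEt.le
  rw [hEt] at this
  linarith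

end EFSys

lemma EFSys.boundary {b γ p : ℝ} {V W : ℝ → ℝ} (S : EFSys b γ p V W) (V1 : V 1 = 0) {N : ℝ}
    (hN : 0 < N) (hγN : γ ≤ (N / 2) ^ 2) {r : ℝ} (hr : r ∈ Ioc (0 : ℝ) 1) :
    r ^ N * (γ * V r ^ 2) ≤ W 1 ^ 2 := by
  have hγ := S.hγ
  have hp := S.hp
  have hE1 : 2 * efE γ p V W 1 = W 1 ^ 2 := by
    rw [efE, V1, gPot_zero γ p S.hp]; ring
  have hW : ∀ x ∈ Icc (0 : ℝ) 1, W x ^ 2 ≤ W 1 ^ 2 + γ * V x ^ 2 := by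
    intro x hx
    have h1 := EFSys.W_sq (γ := γ) (p := p) (V := V) (W := W) x
    have h2 := S.E_mono hx ⟨zero_le_one, le_rfl⟩ hx.2
    have h3 : gPot γ p (V x) ≤ γ * V x ^ 2 := by
      unfold gPot
      have : 0 ≤ 2 * |V x| ^ (p + 1) / (p + 1) := by
        have : 0 < p + 1 := by linarith
        positivity
      linarith
    linarith
  have hd : ∀ x ∈ Ioo r 1, HasDerivAt (fun x => x ^ N * (W 1 ^ 2 + γ * V x ^ 2))
      (x ^ (N - 1) * (N * (W 1 ^ 2 + γ * V x ^ 2) + 2 * γ * V x * W x)) x := by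
    intro x hx
    have hx0 : 0 < x := hr.1.trans hx.1
    have h1 := Real.hasDerivAt_rpow_const (x := x) (p := N) (Or.inl hx0.ne')
    have h2 := ((((S.dV x ⟨hx0, hx.2⟩).pow 2).const_mul γ).const_add (W 1 ^ 2))
    refine (h1.mul h2).congr_deriv ?_
    have : x ^ N = x ^ (N - 1) * x := by
      rw [← Real.rpow_add_one hx0.ne']; congr 1; ring
    simp only [Pi.pow_apply]
    rw [this]
    field_simp
    push_cast
    ring
  have hmono : MonotoneOn (fun x => x ^ N * (W 1 ^ 2 + γ * V x ^ 2)) (Icc r 1) := by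
    apply monotoneOn_of_deriv_nonneg (convex_Icc r 1)
    · apply ContinuousOn.mul
      · exact (Real.continuous_rpow_const hN.le).continuousOn
      · exact continuousOn_const.add (continuousOn_const.mul
          ((S.cV.mono (Icc_subset_Icc hr.1.le le_rfl)).pow 2))
    · rw [interior_Icc]
      exact fun x hx => (hd x hx).differentiableAt.differentiableWithinAt
    · rw [interior_Icc]
      intro x hx
      rw [(hd x hx).deriv]
      have hx0 : 0 < x := hr.1.trans hx.1
      apply mul_nonneg (Real.rpow_nonneg hx0.le _)
      have h1 := hW x ⟨hx0.le, hx.2.le⟩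
      have h2 : 0 ≤ (N / 2) * (W x + (γ / (N / 2)) * V x) ^ 2 := by positivity
      have h3 : (N / 2) * (W x + (γ / (N / 2)) * V x) ^ 2 =
        (N / 2) * W x ^ 2 + 2 * γ * V x * W x + γ * (γ / (N / 2)) * V x ^ 2 := by
        field_simp
        ring
      have h4 : γ / (N / 2) ≤ N / 2 := by
        rw [div_le_iff₀ (by positivity)]; nlinarith
      have h5 : γ * (γ / (N / 2)) * V x ^ 2 ≤ γ * (N / 2) * V x ^ 2 := by gcongr
      have h6 : 0 ≤ W 1 ^ 2 := sq_nonneg _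
      nlinarith
  have h := hmono ⟨le_rfl, hr.2⟩ ⟨hr.2, le_rfl⟩ hr.2
  simp only [V1, Real.one_rpow] at h
  have : 0 ≤ r ^ N * W 1 ^ 2 := mul_nonneg (Real.rpow_nonneg hr.1.le _) (sq_nonneg _)
  nlinarith

/-! ### From radial solutions to the system -/

/-- one-sided derivative on `[0,1]` -/
def uOne (u : ℝ → ℝ) : ℝ → ℝ := derivWithin u (Icc 0 1)

section radial

variable {n : ℕ} {p : ℝ} {u : ℝ → ℝ}

lemma uOne_cont (h : IsRadialSolution n p u) : ContinuousOn (uOne u) (Icc 0 1) :=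
  h.1.continuousOn_derivWithin (uniqueDiffOn_Icc zero_lt_one) (by norm_num)

lemma u_deriv (h : IsRadialSolution n p u) {r : ℝ} (hr : r ∈ Ioo (0 : ℝ) 1) :
    HasDerivAt u (uOne u r) r := by
  have h1 : DifferentiableOn ℝ u (Icc 0 1) := h.1.differentiableOn (by norm_num)
  exact (h1 r ⟨hr.1.le, hr.2.le⟩).hasDerivWithinAt.hasDerivAt (Icc_mem_nhds hr.1 hr.2)

lemma uOne_diff (h : IsRadialSolution n p u) {r : ℝ} (hr : r ∈ Ioo (0 : ℝ) 1) :
    DifferentiableAt ℝ (uOne u) r := by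
  have h1 : ContDiffOn ℝ 1 (uOne u) (Icc 0 1) :=
    h.1.derivWithin (uniqueDiffOn_Icc zero_lt_one) (by norm_num)
  exact (h1.differentiableOn (by norm_num) r ⟨hr.1.le, hr.2.le⟩).differentiableAt
    (Icc_mem_nhds hr.1 hr.2)

lemma y_deriv (h : IsRadialSolution n p u) {r : ℝ} (hr : r ∈ Ioo (0 : ℝ) 1) :
    HasDerivAt (fun s => s ^ (n - 1) * uOne u s) (-(|u r| ^ (p - 1) * u r * r ^ (n - 1))) r := by
  have h1 : DifferentiableAt ℝ (fun s => s ^ (n - 1) * uOne u s) r :=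
    (differentiableAt_pow (n - 1)).mul (uOne_diff h hr)
  have h2 := h1.hasDerivAt
  have h3 : (fun s => s ^ (n - 1) * uOne u s) =ᶠ[𝓝 r] fun s => s ^ (n - 1) * deriv u s := by
    filter_upwards [Ioo_mem_nhds hr.1 hr.2] with s hs
    rw [(u_deriv h hs).deriv]
  rw [h3.deriv_eq, h.2.2 r ⟨hr.1, hr.2.le⟩] at h2
  exact h2

lemma uOne_deriv (hn : 3 ≤ n) (h : IsRadialSolution n p u) {r : ℝ} (hr : r ∈ Ioo (0 : ℝ) 1) :
    HasDerivAt (uOne u) (-(|u r| ^ (p - 1) * u r) - ((n : ℝ) - 1) / r * uOne u r) r := by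
  have h1 := (uOne_diff h hr).hasDerivAt
  have h2 := ((hasDerivAt_pow (n - 1) r).mul h1).unique (y_deriv h hr)
  refine h1.congr_deriv ?_
  obtain ⟨k, rfl⟩ : ∃ k, n = k + 2 := ⟨n - 2, by omega⟩
  simp only [show k + 2 - 1 = k + 1 by omega, show k + 1 - 1 = k by omega] at h2
  push_cast at h2 ⊢
  have hr0 := hr.1.ne'
  have hk : r ^ k ≠ 0 := pow_ne_zero _ hr0
  have h3 : r ^ k * (((k : ℝ) + 1) * uOne u r + r * deriv (uOne u) r) =
      r ^ k * (-(|u r| ^ (p - 1) * u r * r)) := by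
    rw [pow_succ] at h2; linarith
  have h4 := mul_left_cancel₀ hk h3
  field_simp
  linarith

lemma toSys (hn : 3 ≤ n) (h : IsRadialSolution n p u) {α : ℝ} (hp : 1 < p)
    (hα : α = 2 / (p - 1)) (hb : 0 < 2 * α - ((n : ℝ) - 2)) (hγ : 0 < α * ((n : ℝ) - 2 - α))
    (hfin : {r | r ∈ Ioo (0 : ℝ) 1 ∧ u r = 0}.Finite) :
    EFSys (2 * α - ((n : ℝ) - 2)) (α * ((n : ℝ) - 2 - α)) p (fun r => r ^ α * u r)
      (fun r => r ^ α * (r * uOne u r + α * u r)) := by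
  have hα0 : 0 < α := by rw [hα]; exact div_pos two_pos (by linarith)
  have hαp : α * (p - 1) = 2 := by
    have : p - 1 ≠ 0 := by linarith
    rw [hα]; field_simp
  have cu : ContinuousOn u (Icc 0 1) := h.1.continuousOn
  have cr : ContinuousOn (fun r : ℝ => r ^ α) (Icc 0 1) :=
    (Real.continuous_rpow_const hα0.le).continuousOn
  have dr : ∀ r ∈ Ioo (0 : ℝ) 1, HasDerivAt (fun r : ℝ => r ^ α) (α * r ^ α / r) r := by
    intro r hr
    refine (Real.hasDerivAt_rpow_const (Or.inl hr.1.ne')).congr_deriv ?_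
    rw [Real.rpow_sub_one hr.1.ne']; ring
  refine ⟨hb, hγ, hp, cr.mul cu, cr.mul ((continuousOn_id.mul (uOne_cont h)).add
    (continuousOn_const.mul cu)), ?_, ?_, ?_, ?_, ?_⟩
  · simp [Real.zero_rpow hα0.ne']
  · simp [Real.zero_rpow hα0.ne']
  · intro r hr
    have hr0 := hr.1.ne'
    refine ((dr r hr).mul (u_deriv h hr)).congr_deriv ?_
    field_simp
    ring
  · intro r hr
    have hr0 := hr.1.ne'
    have h1 := ((hasDerivAt_id r).mul (uOne_deriv hn h hr)).add ((u_deriv h hr).const_mul α)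
    refine ((dr r hr).mul h1).congr_deriv ?_
    have e : |r ^ α * u r| ^ (p - 1) = r ^ 2 * |u r| ^ (p - 1) := by
      rw [abs_mul, abs_of_nonneg (Real.rpow_nonneg hr.1.le _),
        Real.mul_rpow (Real.rpow_nonneg hr.1.le _) (abs_nonneg _), ← Real.rpow_mul hr.1.le, hαp]
      norm_num
    rw [e]
    simp only [Pi.add_apply, Pi.mul_apply, id]
    field_simp
    ring
  · refine hfin.subset ?_
    rintro r ⟨hr, h0⟩
    refine ⟨hr, ?_⟩
    rcases mul_eq_zero.1 h0 with h' | h'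
    · exact absurd h' (Real.rpow_pos_of_pos hr.1 _).ne'
    · exact h'

lemma boundary_asymp (hn : 3 ≤ n) (h : IsRadialSolution n p u) (hp : 1 < p) (u1 : u 1 = 0)
    {a M : ℝ} (ha : a ∈ Ioo (0 : ℝ) 1) (hM : ∀ r ∈ Icc a 1, |u r| ≤ M) :
    ∀ r ∈ Icc a 1, |u r - uOne u 1 * ((1 - r ^ ((2 : ℝ) - n)) / ((n : ℝ) - 2))| ≤
      a ^ (1 - (n : ℝ)) * M ^ p := by
  have hM0 : 0 ≤ M := (abs_nonneg _).trans (hM 1 ⟨ha.2.le, le_rfl⟩)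
  have hn' : (3 : ℝ) ≤ n := by exact_mod_cast hn
  have hIcc : ∀ r, a ≤ r → Icc r 1 ⊆ Icc (0 : ℝ) 1 := fun r hr =>
    Icc_subset_Icc (ha.1.le.trans hr) le_rfl
  have hY : ∀ r ∈ Icc a 1, |uOne u 1 - r ^ (n - 1) * uOne u r| ≤ M ^ p := by
    intro r hr
    have hk := norm_image_sub_le_of_norm_deriv_right_le_segment (a := r) (b := 1)
      (f := fun s => s ^ (n - 1) * uOne u s) (C := M ^ p)
      (f' := fun r => -(|u r| ^ (p - 1) * u r * r ^ (n - 1)))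
      (((continuousOn_pow (n - 1)).mul (uOne_cont h)).mono (hIcc r hr.1))
      (fun s hs => (y_deriv h ⟨ha.1.trans_le (hr.1.trans hs.1), hs.2⟩).hasDerivWithinAt)
      (fun s hs => ?_) 1 ⟨hr.2, le_rfl⟩
    · simp only [one_pow, one_mul, Real.norm_eq_abs] at hk
      have : 0 ≤ M ^ p := Real.rpow_nonneg hM0 _
      have : M ^ p * (1 - r) ≤ M ^ p * 1 := by
        apply mul_le_mul_of_nonneg_left _ this
        linarith [ha.1.trans_le hr.1]
      linarith
    · have hs0 : 0 < s := ha.1.trans_le (hr.1.trans hs.1)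
      rw [norm_neg, norm_mul, norm_mul, Real.norm_eq_abs, Real.norm_eq_abs, Real.norm_eq_abs,
        abs_of_nonneg (Real.rpow_nonneg (abs_nonneg _) _), abs_of_nonneg (pow_nonneg hs0.le _)]
      have h1 : |u s| ^ (p - 1) * |u s| = |u s| ^ p := by
        rcases (abs_nonneg (u s)).eq_or_lt with h0 | h0
        · rw [← h0, Real.zero_rpow (by linarith), Real.zero_rpow (by linarith)]; simp
        · rw [← Real.rpow_add_one h0.ne']; congr 1; ring
      rw [h1]
      have h2 : |u s| ^ p ≤ M ^ p :=
        Real.rpow_le_rpow (abs_nonneg _) (hM s ⟨hr.1.trans hs.1, hs.2.le⟩) (by linarith)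
      have h3 : s ^ (n - 1) ≤ 1 := pow_le_one₀ hs0.le hs.2.le
      have h4 : 0 ≤ |u s| ^ p := Real.rpow_nonneg (abs_nonneg _) _
      nlinarith
  intro r hr
  have hd : ∀ s ∈ Ico r 1, HasDerivAt
      (fun s => u s - uOne u 1 * ((1 - s ^ ((2 : ℝ) - n)) / ((n : ℝ) - 2)))
      (uOne u s - uOne u 1 * s ^ (1 - (n : ℝ))) s := by
    intro s hs
    have hs0 : 0 < s := ha.1.trans_le (hr.1.trans hs.1)
    have h1 := Real.hasDerivAt_rpow_const (x := s) (p := (2 : ℝ) - n) (Or.inl hs0.ne')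
    refine ((u_deriv h ⟨hs0, hs.2⟩).sub
      (((h1.const_sub 1).div_const ((n : ℝ) - 2)).const_mul (uOne u 1))).congr_deriv ?_
    rw [show (2 : ℝ) - n - 1 = 1 - n by ring]
    have : (n : ℝ) - 2 ≠ 0 := by linarith
    field_simp
    ring
  have hk := norm_image_sub_le_of_norm_deriv_right_le_segment (a := r) (b := 1)
      (f := fun s => u s - uOne u 1 * ((1 - s ^ ((2 : ℝ) - n)) / ((n : ℝ) - 2)))
      (C := a ^ (1 - (n : ℝ)) * M ^ p)
      (f' := fun s => uOne u s - uOne u 1 * s ^ (1 - (n : ℝ))) ?_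
      (fun s hs => (hd s hs).hasDerivWithinAt)
      (fun s hs => ?_) 1 ⟨hr.2, le_rfl⟩
  · simp only [u1, Real.one_rpow, sub_self, zero_div, mul_zero, zero_sub, norm_neg,
      Real.norm_eq_abs] at hk
    have h0 : 0 ≤ a ^ (1 - (n : ℝ)) * M ^ p :=
      mul_nonneg (Real.rpow_nonneg ha.1.le _) (Real.rpow_nonneg hM0 _)
    have : a ^ (1 - (n : ℝ)) * M ^ p * (1 - r) ≤ a ^ (1 - (n : ℝ)) * M ^ p * 1 := by
      apply mul_le_mul_of_nonneg_left _ h0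
      linarith [ha.1.trans_le hr.1]
    linarith
  · apply ((h.1.continuousOn).mono (hIcc r hr.1)).sub
    apply continuousOn_const.mul
    apply ContinuousOn.div_const
    apply continuousOn_const.sub
    exact fun s hs => (Real.continuousAt_rpow_const _ _
      (Or.inl (ha.1.trans_le (hr.1.trans hs.1)).ne')).continuousWithinAt
  · have hs0 : 0 < s := ha.1.trans_le (hr.1.trans hs.1)
    have e : s ^ (1 - (n : ℝ)) * s ^ (n - 1) = 1 := by
      rw [← Real.rpow_natCast, ← Real.rpow_add hs0, Nat.cast_sub (by omega)]
      simp
    have e2 : uOne u s - uOne u 1 * s ^ (1 - (n : ℝ)) =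
        - (s ^ (1 - (n : ℝ)) * (uOne u 1 - s ^ (n - 1) * uOne u s)) := by
      linear_combination (-(uOne u s)) * e
    rw [e2, norm_neg, norm_mul, Real.norm_eq_abs, Real.norm_eq_abs,
      abs_of_nonneg (Real.rpow_nonneg hs0.le _)]
    apply mul_le_mul _ (hY s ⟨hr.1.trans hs.1, hs.2.le⟩) (abs_nonneg _)
      (Real.rpow_nonneg ha.1.le _)
    exact Real.rpow_le_rpow_of_nonpos ha.1 (hr.1.trans hs.1) (by linarith)

end radial

/-! ### The Beta integral and limits -/

lemma beta_real {x y : ℝ} (hx : 0 < x) (hy : 0 < y) :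
    ∫ t in (0 : ℝ)..1, t ^ (x - 1) * (1 - t) ^ (y - 1) =
      Real.Gamma x * Real.Gamma y / Real.Gamma (x + y) := by
  have h := ProbabilityTheory.beta_eq_betaIntegralReal x y hx hy
  rw [ProbabilityTheory.beta] at h
  rw [h, Complex.betaIntegral]
  have e : ∫ t in (0 : ℝ)..1, (t : ℂ) ^ ((x : ℂ) - 1) * (1 - (t : ℂ)) ^ ((y : ℂ) - 1) =
      ∫ t in (0 : ℝ)..1, ((t ^ (x - 1) * (1 - t) ^ (y - 1) : ℝ) : ℂ) := by
    apply intervalIntegral.integral_congr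
    intro t ht
    rw [uIcc_of_le zero_le_one] at ht
    simp only
    push_cast
    rw [Complex.ofReal_cpow ht.1, Complex.ofReal_cpow (by linarith [ht.2])]
    push_cast
    rfl
  rw [e, intervalIntegral.integral_ofReal, Complex.ofReal_re]

lemma beta_sqrt {N : ℝ} (hN : 0 < N) :
    ∫ t in Ioi (0 : ℝ), t ^ (N / 2 - 1) * √(1 - t) =
      Real.Gamma (N / 2) * Real.Gamma (3 / 2) / Real.Gamma (N / 2 + 3 / 2) := by
  rw [← beta_real (by positivity) (by norm_num), intervalIntegral.integral_of_le zero_le_one]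
  rw [setIntegral_eq_of_subset_of_forall_sdiff_eq_zero measurableSet_Ioi
    (show Ioc (0 : ℝ) 1 ⊆ Ioi 0 from fun x hx => hx.1)]
  · apply setIntegral_congr_fun measurableSet_Ioc
    intro t ht
    simp only
    rw [Real.sqrt_eq_rpow]
    norm_num
  · rintro t ⟨ht0, ht⟩
    have h0 : 0 < t := ht0
    have : 1 < t := by
      by_contra hc
      exact ht ⟨h0, not_lt.1 hc⟩
    rw [Real.sqrt_eq_zero_of_nonpos (by linarith), mul_zero]

lemma gamma_id {N : ℝ} (hN : 0 < N) :
    Real.Gamma (N / 2) * Real.Gamma (3 / 2) / Real.Gamma (N / 2 + 3 / 2) =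
      2 ^ (N + 1) * Real.Gamma ((N + 2) / 2) ^ 2 / (N * Real.Gamma (N + 2)) := by
  have h1 := Real.Gamma_mul_Gamma_add_half ((N + 2) / 2)
  have h2 : Real.Gamma ((N + 2) / 2) = N / 2 * Real.Gamma (N / 2) := by
    rw [← Real.Gamma_add_one (by positivity)]; congr 1; ring
  have h3 : Real.Gamma (3 / 2) = 1 / 2 * √π := by
    rw [← Real.Gamma_one_half_eq, ← Real.Gamma_add_one (by norm_num)]; norm_num
  rw [show (N + 2) / 2 + 1 / 2 = N / 2 + 3 / 2 by ring, show 2 * ((N + 2) / 2) = N + 2 by ring,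
    show 1 - (N + 2) = -(N + 1) by ring, Real.rpow_neg two_pos.le] at h1
  have p1 : Real.Gamma (N / 2) ≠ 0 := (Real.Gamma_pos_of_pos (by positivity)).ne'
  have p2 : Real.Gamma (N / 2 + 3 / 2) ≠ 0 := (Real.Gamma_pos_of_pos (by positivity)).ne'
  have p3 : Real.Gamma (N + 2) ≠ 0 := (Real.Gamma_pos_of_pos (by positivity)).ne'
  have p4 : (2 : ℝ) ^ (N + 1) ≠ 0 := (Real.rpow_pos_of_pos two_pos _).ne'
  rw [div_eq_div_iff p2 (mul_ne_zero hN.ne' p3), h3]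
  rw [h2] at h1 ⊢
  field_simp at h1 ⊢
  linear_combination (-1) * h1

lemma kappa_eq {n : ℕ} (hn : 3 ≤ n) {R : ℝ} (hR0 : 0 ≤ R)
    (hR : ∀ s, R < s → gPot ((((n : ℝ) - 2) / 2) ^ 2) (pEps n 0) s ≤ 0) :
    hPrim ((((n : ℝ) - 2) / 2) ^ 2) (pEps n 0) 0 R =
      kappa n * ((n : ℝ) * ((n : ℝ) - 2)) ^ (((n : ℝ) - 2) / 2) := by
  have hn' : (3 : ℝ) ≤ n := by exact_mod_cast hn
  obtain ⟨N, hNdef⟩ : ∃ N : ℝ, N = (n : ℝ) - 2 := ⟨_, rfl⟩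
  have hnN : (n : ℝ) = N + 2 := by linarith
  have hN : 0 < N := by linarith
  have hp0 : pEps n 0 = 1 + 4 / N := by
    unfold pEps
    rw [hnN, show N + 2 - 2 = N by ring]
    field_simp
    ring
  rw [hp0] at hR ⊢
  rw [kappa]
  rw [hnN] at hR ⊢
  rw [show N + 2 - 2 = N by ring] at hR ⊢
  set k : ℝ := 4 / (N * (N + 2)) with hk
  have hk0 : 0 < k := by positivity
  have hg : ∀ s : ℝ, 0 < s → gPot ((N / 2) ^ 2) (1 + 4 / N) s =
      (s * (N / 2)) ^ 2 * (1 - k * s ^ (4 / N)) := by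
    intro s hs
    rw [gPot, abs_of_pos hs, show 1 + 4 / N + 1 = 4 / N + (2 : ℕ) by push_cast; ring,
      Real.rpow_add_natCast hs.ne', hk]
    push_cast
    field_simp
    ring
  have e1 : hPrim ((N / 2) ^ 2) (1 + 4 / N) 0 R =
      ∫ s in Ioi (0 : ℝ), s * (N / 2) * √(1 - k * s ^ (4 / N)) := by
    unfold hPrim
    rw [intervalIntegral.integral_of_le hR0]
    rw [setIntegral_eq_of_subset_of_forall_sdiff_eq_zero measurableSet_Ioi
      (show Ioc (0 : ℝ) R ⊆ Ioi 0 from fun x hx => hx.1)]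
    · apply setIntegral_congr_fun measurableSet_Ioc
      intro s hs
      have hs0 : 0 < s := hs.1
      simp only
      rw [mul_zero, zero_add, hg s hs0, Real.sqrt_mul (sq_nonneg _), Real.sqrt_sq (by positivity)]
    · rintro s ⟨hs0, hs⟩
      have h0 : 0 < s := hs0
      have h1 : R < s := by
        by_contra hc
        exact hs ⟨h0, not_lt.1 hc⟩
      have h2 := hR s h1
      rw [hg s h0] at h2
      have h3 : 0 < (s * (N / 2)) ^ 2 := by positivity
      rw [Real.sqrt_eq_zero_of_nonpos (by nlinarith), mul_zero]
  have e2 := integral_comp_rpow_Ioi_of_pos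
    (g := fun s : ℝ => s * (N / 2) * √(1 - k * s ^ (4 / N))) (p := N / 4) (by positivity)
  have e3 := integral_comp_mul_left_Ioi
    (fun x : ℝ => (x / k) ^ (N / 2 - 1) * √(1 - x)) 0 hk0
  rw [e1, ← e2]
  have e4 : ∫ x in Ioi (0 : ℝ), (N / 4 * x ^ (N / 4 - 1)) •
      (x ^ (N / 4) * (N / 2) * √(1 - k * (x ^ (N / 4)) ^ (4 / N))) =
      ∫ x in Ioi (0 : ℝ), (N ^ 2 / 8) * ((k * x / k) ^ (N / 2 - 1) * √(1 - k * x)) := by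
    apply setIntegral_congr_fun measurableSet_Ioi
    intro x hx
    have hx0 : 0 < x := hx
    simp only [smul_eq_mul]
    rw [← Real.rpow_mul hx0.le, show N / 4 * (4 / N) = 1 by field_simp, Real.rpow_one,
      mul_div_cancel_left₀ _ hk0.ne']
    have : x ^ (N / 2 - 1) = x ^ (N / 4 - 1) * x ^ (N / 4) := by
      rw [← Real.rpow_add hx0]; congr 1; ring
    rw [this]; ring
  rw [e4, integral_const_mul, e3, mul_zero]
  have e5 : ∫ x in Ioi (0 : ℝ), (x / k) ^ (N / 2 - 1) * √(1 - x) =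
      ∫ x in Ioi (0 : ℝ), (k ^ (N / 2 - 1))⁻¹ * (x ^ (N / 2 - 1) * √(1 - x)) := by
    apply setIntegral_congr_fun measurableSet_Ioi
    intro x hx
    have hx0 : 0 < x := hx
    simp only
    rw [Real.div_rpow hx0.le hk0.le]; ring
  rw [e5, integral_const_mul, beta_sqrt hN, gamma_id hN]
  have p3 : Real.Gamma (N + 2) ≠ 0 := (Real.Gamma_pos_of_pos (by positivity)).ne'
  have hkk : k⁻¹ * (k ^ (N / 2 - 1))⁻¹ = ((N + 2) * N) ^ (N / 2) / 2 ^ N := by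
    rw [Real.rpow_sub_one hk0.ne', hk, Real.div_rpow (by norm_num) (by positivity),
      show (4 : ℝ) = 2 ^ (2 : ℝ) by norm_num, ← Real.rpow_mul two_pos.le,
      show 2 * (N / 2) = N by ring, mul_comm (N + 2) N]
    have : (2 : ℝ) ^ N ≠ 0 := (Real.rpow_pos_of_pos two_pos _).ne'
    have : (N * (N + 2)) ^ (N / 2) ≠ 0 := (Real.rpow_pos_of_pos (by positivity) _).ne'
    field_simp
  rw [smul_eq_mul]
  have e6 : (2 : ℝ) ^ (N + 1) = 2 ^ N * 2 := Real.rpow_add_one two_ne_zero N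
  have p4 : (2 : ℝ) ^ N ≠ 0 := (Real.rpow_pos_of_pos two_pos _).ne'
  calc _ = N ^ 2 / 8 * ((k⁻¹ * (k ^ (N / 2 - 1))⁻¹) *
        (2 ^ (N + 1) * Gamma ((N + 2) / 2) ^ 2 / (N * Gamma (N + 2)))) := by ring
    _ = _ := by
      rw [hkk, e6]
      field_simp
      ring

lemma R_exists {N : ℝ} (hN : 0 < N) : ∃ R : ℝ, 1 ≤ R ∧ ∀ γ p η : ℝ, γ ≤ (N / 2) ^ 2 →
    1 + 2 / N ≤ p → p ≤ 1 + 4 / N → η ≤ 1 → ∀ s, R < s → 2 * η + gPot γ p s < 0 := by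
  set A : ℝ := (2 + (N / 2) ^ 2) * (2 + 4 / N) / 2 with hA
  have hA0 : 0 < A := by positivity
  refine ⟨max 1 (A ^ (N / 2)), le_max_left _ _, ?_⟩
  intro γ p η hγ hp1 hp2 hη s hs
  have hs1 : 1 < s := (le_max_left _ _).trans_lt hs
  have hs0 : 0 < s := by linarith
  have hsA : A ^ (N / 2) < s := (le_max_right _ _).trans_lt hs
  have h1 : A < s ^ (2 / N) := by
    have := Real.rpow_lt_rpow (Real.rpow_nonneg hA0.le _) hsA (z := 2 / N) (by positivity)
    rwa [← Real.rpow_mul hA0.le, show N / 2 * (2 / N) = 1 by field_simp, Real.rpow_one] at this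
  have h2 : s ^ (2 / N) ≤ s ^ (p - 1) := Real.rpow_le_rpow_of_exponent_le hs1.le (by linarith)
  have hpp : 0 < p + 1 := by have : 0 < 2 / N := by positivity
                             linarith
  rw [gPot, abs_of_pos hs0, show p + 1 = (p - 1) + (2 : ℕ) by push_cast; ring,
    Real.rpow_add_natCast hs0.ne', show p - 1 + ((2 : ℕ) : ℝ) = p + 1 by push_cast; ring]
  have h3 : 2 + (N / 2) ^ 2 < 2 * s ^ (p - 1) / (p + 1) := by
    rw [lt_div_iff₀ hpp]
    have : (2 + (N / 2) ^ 2) * (p + 1) ≤ (2 + (N / 2) ^ 2) * (2 + 4 / N) := by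
      apply mul_le_mul_of_nonneg_left _ (by positivity)
      linarith
    linarith
  have h4 : 1 < s ^ 2 := by nlinarith
  have h5 : 2 * (s ^ (p - 1) * s ^ 2) / (p + 1) = s ^ 2 * (2 * s ^ (p - 1) / (p + 1)) := by ring
  rw [h5]
  nlinarith

lemma hPrim_tendsto {l : Filter ℝ} [l.IsCountablyGenerated] {γ p η : ℝ → ℝ} {γ0 p0 η0 : ℝ}
    (hγ : Tendsto γ l (𝓝 γ0)) (hp : Tendsto p l (𝓝 p0)) (hη : Tendsto η l (𝓝 η0))
    (hp0 : 1 < p0) {R : ℝ} :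
    Tendsto (fun ε => hPrim (γ ε) (p ε) (η ε) R) l (𝓝 (hPrim γ0 p0 η0 R)) := by
  unfold hPrim
  have hp1 : ∀ᶠ ε in l, 1 < p ε := hp.eventually (lt_mem_nhds hp0)
  apply intervalIntegral.tendsto_integral_filter_of_dominated_convergence
    (fun s => √(2 * (|η0| + 1) + (|γ0| + 1) * s ^ 2))
  · filter_upwards [hp1] with ε h
    exact (hInt_continuous _ _ _ h).aestronglyMeasurable
  · have h1 : ∀ᶠ ε in l, η ε < |η0| + 1 :=
      hη.eventually (gt_mem_nhds (by linarith [le_abs_self η0]))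
    have h2 : ∀ᶠ ε in l, γ ε < |γ0| + 1 :=
      hγ.eventually (gt_mem_nhds (by linarith [le_abs_self γ0]))
    filter_upwards [h1, h2, hp1] with ε a1 a2 a3
    refine Eventually.of_forall fun s _ => ?_
    rw [Real.norm_eq_abs, abs_of_nonneg (Real.sqrt_nonneg _)]
    apply Real.sqrt_le_sqrt
    unfold gPot
    have : 0 ≤ 2 * |s| ^ (p ε + 1) / (p ε + 1) := by
      have : 0 < p ε + 1 := by linarith
      positivity
    nlinarith [sq_nonneg s]
  · apply Continuous.intervalIntegrable
    fun_prop
  · refine Eventually.of_forall fun s _ => ?_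
    apply Tendsto.sqrt
    apply (hη.const_mul 2).add
    unfold gPot
    apply (hγ.mul_const _).sub
    have h3 : Tendsto (fun ε => p ε + 1) l (𝓝 (p0 + 1)) := hp.add_const 1
    apply Tendsto.div _ h3 (by linarith)
    apply Tendsto.const_mul
    exact ((Real.continuousAt_const_rpow' (a := |s|) (b := p0 + 1) (by linarith)).tendsto).comp h3

/-! ### Asymptotics -/

/-- the Emden-Fowler exponent `2/(p-1)` -/
def alE (n : ℕ) (ε : ℝ) : ℝ := 2 / (pEps n ε - 1)

lemma pEps_eq {n : ℕ} (hn : 3 ≤ n) (ε : ℝ) : pEps n ε = 1 + 4 / ((n : ℝ) - 2) - ε := by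
  have hn' : (3 : ℝ) ≤ n := by exact_mod_cast hn
  have : (n : ℝ) - 2 ≠ 0 := by linarith
  unfold pEps
  congr 1
  rw [eq_comm, ← sub_eq_zero]
  field_simp
  ring

lemma alE_eq {n : ℕ} (hn : 3 ≤ n) (ε : ℝ) : alE n ε = 2 / (4 / ((n : ℝ) - 2) - ε) := by
  rw [alE, pEps_eq hn]; congr 1; ring

lemma params {n : ℕ} (hn : 3 ≤ n) {ε : ℝ} (hε : ε ∈ Ioo (0 : ℝ) (2 / ((n : ℝ) - 2))) :
    1 + 2 / ((n : ℝ) - 2) ≤ pEps n ε ∧ pEps n ε ≤ 1 + 4 / ((n : ℝ) - 2) ∧ 1 < pEps n ε ∧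
    0 < 2 * alE n ε - ((n : ℝ) - 2) ∧ alE n ε < (n : ℝ) - 2 ∧ 0 < alE n ε ∧
    alE n ε * ((n : ℝ) - 2 - alE n ε) ≤ (((n : ℝ) - 2) / 2) ^ 2 ∧
    ε ∈ Ioo (0 : ℝ) (4 / ((n : ℝ) - 2)) := by
  have hn' : (3 : ℝ) ≤ n := by exact_mod_cast hn
  rw [alE_eq hn, pEps_eq hn]
  set N : ℝ := (n : ℝ) - 2 with hNd
  have hN : 0 < N := by linarith
  have h2 : 0 < 2 / N := by positivity
  have h4 : 4 / N = 2 / N + 2 / N := by ring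
  obtain ⟨h0, h1⟩ := hε
  have hd : 0 < 4 / N - ε := by linarith
  refine ⟨by linarith, by linarith, by linarith, ?_, ?_, by positivity, ?_, h0, by linarith⟩
  · have : N / 2 < 2 / (4 / N - ε) := by
      rw [lt_div_iff₀ hd]
      have : N / 2 * (4 / N) = 2 := by field_simp; norm_num
      nlinarith
    linarith
  · rw [div_lt_iff₀ hd]
    have : N * (4 / N) = 4 := by field_simp
    have : N * (2 / N) = 2 := by field_simp
    nlinarith
  · nlinarith [sq_nonneg (2 / (4 / N - ε) - N / 2)]

lemma alE_tendsto {n : ℕ} (hn : 3 ≤ n) :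
    Tendsto (alE n) (𝓝[>] 0) (𝓝 (((n : ℝ) - 2) / 2)) := by
  have hn' : (3 : ℝ) ≤ n := by exact_mod_cast hn
  have hN : 0 < (n : ℝ) - 2 := by linarith
  have h : ContinuousAt (fun ε : ℝ => 2 / (4 / ((n : ℝ) - 2) - ε)) 0 := by
    apply ContinuousAt.div continuousAt_const (by fun_prop)
    rw [sub_zero]; positivity
  have h2 := h.tendsto.mono_left (nhdsWithin_le_nhds (s := Ioi 0))
  rw [funext (alE_eq hn)]
  convert h2 using 2
  rw [sub_zero]
  field_simp
  norm_num

lemma b_tendsto {n : ℕ} (hn : 3 ≤ n) :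
    Tendsto (fun ε => (2 * alE n ε - ((n : ℝ) - 2)) / ε) (𝓝[>] 0)
      (𝓝 (((n : ℝ) - 2) ^ 2 / 4)) := by
  have hn' : (3 : ℝ) ≤ n := by exact_mod_cast hn
  have hN : 0 < (n : ℝ) - 2 := by linarith
  have h := (alE_tendsto hn).mul_const (((n : ℝ) - 2) / 2)
  rw [show ((n : ℝ) - 2) / 2 * (((n : ℝ) - 2) / 2) = ((n : ℝ) - 2) ^ 2 / 4 by ring] at h
  refine h.congr' ?_
  have hpos : (0 : ℝ) < 2 / ((n : ℝ) - 2) := by positivity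
  filter_upwards [Ioo_mem_nhdsGT hpos] with ε hε
  have hd : 4 / ((n : ℝ) - 2) - ε ≠ 0 := by
    have : 4 / ((n : ℝ) - 2) = 2 / ((n : ℝ) - 2) + 2 / ((n : ℝ) - 2) := by ring
    linarith [hε.2]
  have hε0 := hε.1.ne'
  rw [alE_eq hn]
  set D := 4 / ((n : ℝ) - 2) - ε with hD
  have hε' : ε = 4 / ((n : ℝ) - 2) - D := by rw [hD]; ring
  rw [eq_div_iff hε0, hε']
  field_simp
  ring

section final

variable {n m : ℕ} {u : ℝ → ℝ → ℝ}

lemma omega_lim (hn : 3 ≤ n) (hm : 1 ≤ m)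
    (hu : ∀ ε ∈ Set.Ioo (0 : ℝ) (4 / ((n : ℝ) - 2)), DirichletSol n (pEps n ε) m (u ε)) :
    Tendsto (fun ε => uOne (u ε) 1 ^ 2 / ε) (𝓝[>] 0)
      (𝓝 (m * ((n : ℝ) - 2) ^ 2 *
        (kappa n * ((n : ℝ) * ((n : ℝ) - 2)) ^ (((n : ℝ) - 2) / 2)))) := by
  have hn' : (3 : ℝ) ≤ n := by exact_mod_cast hn
  have hN : 0 < (n : ℝ) - 2 := by linarith
  have hpos : (0 : ℝ) < 2 / ((n : ℝ) - 2) := by positivity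
  obtain ⟨R, hR1, hR⟩ := R_exists hN
  have hR0 : 0 ≤ R := by linarith
  have hp0 : pEps n 0 = 1 + 4 / ((n : ℝ) - 2) := by rw [pEps_eq hn]; ring
  have h24 : 2 / ((n : ℝ) - 2) ≤ 4 / ((n : ℝ) - 2) := by gcongr; norm_num
  have hI := kappa_eq hn hR0 (fun s hs => by
    have := hR _ (pEps n 0) 0 le_rfl (by rw [hp0]; linarith) hp0.le zero_le_one s hs
    linarith)
  set I0 := kappa n * ((n : ℝ) * ((n : ℝ) - 2)) ^ (((n : ℝ) - 2) / 2) with hI0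
  have tα := alE_tendsto hn
  have tε : Tendsto (fun ε : ℝ => ε) (𝓝[>] 0) (𝓝 0) := nhdsWithin_le_nhds
  have tb : Tendsto (fun ε => 2 * alE n ε - ((n : ℝ) - 2)) (𝓝[>] 0) (𝓝 0) := by
    have := (tα.const_mul 2).sub_const ((n : ℝ) - 2)
    convert this using 2
    ring
  have tγ : Tendsto (fun ε => alE n ε * ((n : ℝ) - 2 - alE n ε)) (𝓝[>] 0)
      (𝓝 ((((n : ℝ) - 2) / 2) ^ 2)) := by
    have := tα.mul (tα.const_sub ((n : ℝ) - 2))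
    convert this using 2
    ring
  have tp : Tendsto (pEps n) (𝓝[>] 0) (𝓝 (pEps n 0)) := by
    have : Continuous (pEps n) := by unfold pEps; fun_prop
    exact (this.tendsto 0).mono_left nhdsWithin_le_nhds
  have tη : Tendsto (fun ε => √(2 * alE n ε - ((n : ℝ) - 2))) (𝓝[>] 0) (𝓝 0) := by
    simpa using tb.sqrt
  have hp01 : 1 < pEps n 0 := by rw [hp0]; linarith
  have tH0 := hPrim_tendsto tγ tp (tendsto_const_nhds (x := (0 : ℝ))) hp01 (R := R)
  have tH1 := hPrim_tendsto tγ tp tη hp01 (R := R)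
  rw [hI] at tH0 tH1
  have tB := b_tendsto hn
  have tlow := ((tB.const_mul (4 * (m : ℝ))).mul tH0)
  have tup := ((tB.const_mul (4 * (m : ℝ))).mul tH1)
  rw [show 4 * (m : ℝ) * (((n : ℝ) - 2) ^ 2 / 4) * I0 = m * ((n : ℝ) - 2) ^ 2 * I0 by ring]
    at tlow tup
  have hsm : ∀ᶠ ε in 𝓝[>] (0 : ℝ), 2 * √(2 * alE n ε - ((n : ℝ) - 2)) * m *
      hPrim (alE n ε * ((n : ℝ) - 2 - alE n ε)) (pEps n ε)
        (√(2 * alE n ε - ((n : ℝ) - 2))) R < 1 := by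
    have := ((tη.const_mul 2).mul_const (m : ℝ)).mul tH1
    rw [mul_zero, zero_mul, zero_mul] at this
    exact this.eventually (gt_mem_nhds one_pos)
  have hη1 : ∀ᶠ ε in 𝓝[>] (0 : ℝ), √(2 * alE n ε - ((n : ℝ) - 2)) < 1 :=
    tη.eventually (gt_mem_nhds one_pos)
  have main : ∀ᶠ ε in 𝓝[>] (0 : ℝ),
      4 * (m : ℝ) * ((2 * alE n ε - ((n : ℝ) - 2)) / ε) *
        hPrim (alE n ε * ((n : ℝ) - 2 - alE n ε)) (pEps n ε) 0 R ≤ uOne (u ε) 1 ^ 2 / ε ∧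
      uOne (u ε) 1 ^ 2 / ε ≤ 4 * (m : ℝ) * ((2 * alE n ε - ((n : ℝ) - 2)) / ε) *
        hPrim (alE n ε * ((n : ℝ) - 2 - alE n ε)) (pEps n ε)
          (√(2 * alE n ε - ((n : ℝ) - 2))) R := by
    filter_upwards [hsm, hη1, Ioo_mem_nhdsGT hpos] with ε a1 a2 a3
    obtain ⟨q1, q2, q3, q4, q5, q6, q7, q8⟩ := params hn a3
    obtain ⟨hsol, hu1, -, Z, hZ, hZc⟩ := hu ε q8
    have hε0 := a3.1
    have hfin : {r | r ∈ Ioo (0 : ℝ) 1 ∧ u ε r = 0}.Finite := by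
      rw [← hZ]; exact Z.finite_toSet
    have S := toSys hn hsol (α := alE n ε) q3 rfl q4 (mul_pos q6 (by linarith)) hfin
    set b := 2 * alE n ε - ((n : ℝ) - 2) with hb
    set γ := alE n ε * ((n : ℝ) - 2 - alE n ε) with hγ
    have hZ' : (Z : Set ℝ) = {r | r ∈ Ioo (0 : ℝ) 1 ∧ r ^ alE n ε * u ε r = 0} := by
      rw [hZ]
      ext r
      constructor
      · rintro ⟨h1, h2⟩
        exact ⟨h1, by rw [h2, mul_zero]⟩
      · rintro ⟨h1, h2⟩
        exact ⟨h1, (mul_eq_zero.1 h2).resolve_left (Real.rpow_pos_of_pos h1.1 _).ne'⟩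
    have hsb : 0 < √b := Real.sqrt_pos.2 q4
    have hbb : √b * √b = b := Real.mul_self_sqrt q4.le
    have hE := S.energy (R := R) (η := √b) hsb.le
      (hR γ (pEps n ε) (√b) q7 q1 q2 a2.le) m hm (by simp [hu1]) Z hZ' hZc (by
        have := mul_lt_mul_of_pos_left a1 hsb
        nlinarith)
    have e1 : 2 * efE γ (pEps n ε) (fun r => r ^ alE n ε * u ε r)
        (fun r => r ^ alE n ε * (r * uOne (u ε) r + alE n ε * u ε r)) 1 = uOne (u ε) 1 ^ 2 := by
      simp only [efE, Real.one_rpow, hu1, one_mul, mul_zero, add_zero, gPot_zero _ _ q3]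
      ring
    constructor
    · rw [le_div_iff₀ hε0, ← e1]
      have := hE.1
      calc _ = 2 * (2 * b * m * hPrim γ (pEps n ε) 0 R) := by field_simp; ring
        _ ≤ _ := by linarith
    · rw [div_le_iff₀ hε0, ← e1]
      have := hE.2
      calc _ ≤ 2 * (2 * b * m * hPrim γ (pEps n ε) (√b) R) := by linarith
        _ = _ := by field_simp; ring
  exact tendsto_of_tendsto_of_tendsto_of_le_of_le' tlow tup
    (main.mono fun _ h => h.1) (main.mono fun _ h => h.2)

lemma u_bound (hn : 3 ≤ n)
    (hu : ∀ ε ∈ Set.Ioo (0 : ℝ) (4 / ((n : ℝ) - 2)), DirichletSol n (pEps n ε) m (u ε))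
    {a : ℝ} (ha : a ∈ Ioo (0 : ℝ) 1) :
    ∃ K : ℝ, 0 < K ∧ ∀ᶠ ε in 𝓝[>] (0 : ℝ), ∀ r ∈ Icc a 1,
      |u ε r| ≤ K * |uOne (u ε) 1| := by
  have hn' : (3 : ℝ) ≤ n := by exact_mod_cast hn
  have hN : 0 < (n : ℝ) - 2 := by linarith
  have hpos : (0 : ℝ) < 2 / ((n : ℝ) - 2) := by positivity
  have tα := alE_tendsto hn
  have tγ : Tendsto (fun ε => alE n ε * ((n : ℝ) - 2 - alE n ε)) (𝓝[>] 0)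
      (𝓝 ((((n : ℝ) - 2) / 2) ^ 2)) := by
    have := tα.mul (tα.const_sub ((n : ℝ) - 2))
    convert this using 2
    ring
  have hγ1 : ∀ᶠ ε in 𝓝[>] (0 : ℝ), (((n : ℝ) - 2) / 2) ^ 2 / 2 <
      alE n ε * ((n : ℝ) - 2 - alE n ε) :=
    tγ.eventually (lt_mem_nhds (half_lt_self (by positivity)))
  set N := (n : ℝ) - 2 with hNd
  set c := a ^ (3 * N) * ((N / 2) ^ 2 / 2) with hc
  have hc0 : 0 < c := mul_pos (Real.rpow_pos_of_pos ha.1 _) (by positivity)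
  refine ⟨(√c)⁻¹, by positivity, ?_⟩
  filter_upwards [hγ1, Ioo_mem_nhdsGT hpos] with ε a1 a3 r hr
  obtain ⟨q1, q2, q3, q4, q5, q6, q7, q8⟩ := params hn a3
  obtain ⟨hsol, hu1, -, Z, hZ, hZc⟩ := hu ε q8
  have hfin : {r | r ∈ Ioo (0 : ℝ) 1 ∧ u ε r = 0}.Finite := by
    rw [← hZ]; exact Z.finite_toSet
  have S := toSys hn hsol (α := alE n ε) q3 rfl q4 (mul_pos q6 (by linarith)) hfin
  have hr0 : 0 < r := ha.1.trans_le hr.1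
  have hB := S.boundary (by simp [hu1]) hN q7 (r := r) ⟨hr0, hr.2⟩
  simp only [Real.one_rpow, hu1, one_mul, mul_zero, add_zero] at hB
  have e1 : r ^ N * (alE n ε * (N - alE n ε) * (r ^ alE n ε * u ε r) ^ 2) =
      r ^ (N + alE n ε * 2) * (alE n ε * (N - alE n ε)) * u ε r ^ 2 := by
    rw [Real.rpow_add hr0, Real.rpow_mul hr0.le, Real.rpow_two]
    ring
  rw [e1] at hB
  have e2 : a ^ (3 * N) ≤ r ^ (N + alE n ε * 2) :=
    calc a ^ (3 * N) ≤ r ^ (3 * N) := Real.rpow_le_rpow ha.1.le hr.1 (by positivity)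
      _ ≤ _ := Real.rpow_le_rpow_of_exponent_ge hr0 hr.2 (by linarith)
  have e3 : c ≤ r ^ (N + alE n ε * 2) * (alE n ε * (N - alE n ε)) :=
    mul_le_mul e2 a1.le (by positivity) (Real.rpow_nonneg hr0.le _)
  have e4 : c * u ε r ^ 2 ≤ uOne (u ε) 1 ^ 2 :=
    (mul_le_mul_of_nonneg_right e3 (sq_nonneg _)).trans hB
  have e5 : √c * |u ε r| ≤ |uOne (u ε) 1| := by
    refine (pow_le_pow_iff_left₀ (by positivity) (abs_nonneg _) two_ne_zero).1 ?_
    rw [mul_pow, sq_abs, sq_abs, Real.sq_sqrt hc0.le]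
    exact e4
  rw [inv_mul_eq_div, le_div_iff₀ (Real.sqrt_pos.2 hc0)]
  linarith

end final


/-- **Theorem 1.3, Dirichlet part.** For a radial Dirichlet solution with `m-1` interior
zeros, `|u_ε(r)| (κ_n ε)^{-1/2} → (n(n-2))^{(n-2)/4} m^{1/2} (r^{2-n} - 1)` uniformly on
`[a,1]` for every `a ∈ (0,1)`; in particular `u_ε → 0` uniformly on `[a,1]`. -/
theorem dirichlet_pointwise (n m : ℕ) (hn : 3 ≤ n) (hm : 1 ≤ m)
    (u : ℝ → ℝ → ℝ)
    (hu : ∀ ε ∈ Set.Ioo (0 : ℝ) (4 / ((n : ℝ) - 2)),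
      DirichletSol n (pEps n ε) m (u ε)) :
    ∀ a ∈ Set.Ioo (0 : ℝ) 1,
      TendstoUniformlyOn
        (fun (ε : ℝ) (r : ℝ) => |u ε r| * (kappa n * ε) ^ (-(1 : ℝ) / 2))
        (fun r : ℝ => ((n : ℝ) * ((n : ℝ) - 2)) ^ (((n : ℝ) - 2) / 4) *
          (m : ℝ) ^ ((1 : ℝ) / 2) * (r ^ ((2 : ℝ) - (n : ℝ)) - 1))
        (𝓝[>] (0 : ℝ)) (Set.Icc a 1) ∧
      TendstoUniformlyOn (fun (ε : ℝ) (r : ℝ) => u ε r) (fun _ => 0)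
        (𝓝[>] (0 : ℝ)) (Set.Icc a 1) := by

  intro a ha
  have hn' : (3 : ℝ) ≤ n := by exact_mod_cast hn
  have hN : 0 < (n : ℝ) - 2 := by linarith
  have hpos : (0 : ℝ) < 2 / ((n : ℝ) - 2) := by positivity
  have hκ : 0 < kappa n := by
    unfold kappa
    have h1 : 0 < Real.Gamma ((n : ℝ) / 2) := Real.Gamma_pos_of_pos (by positivity)
    have h2 : 0 < Real.Gamma (n : ℝ) := Real.Gamma_pos_of_pos (by positivity)
    positivity
  obtain ⟨K, hK, hbd⟩ := u_bound hn hu ha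
  have tω2 := omega_lim hn hm hu
  have tε : Tendsto (fun ε : ℝ => ε) (𝓝[>] 0) (𝓝 0) := nhdsWithin_le_nhds
  have tω : Tendsto (fun ε => |uOne (u ε) 1|) (𝓝[>] 0) (𝓝 0) := by
    have h := (tω2.mul tε).sqrt
    rw [mul_zero, Real.sqrt_zero] at h
    refine h.congr' ?_
    filter_upwards [self_mem_nhdsWithin] with ε hε
    rw [div_mul_cancel₀ _ (ne_of_gt hε), Real.sqrt_sq_eq_abs]
  set L : ℝ := ((n : ℝ) * ((n : ℝ) - 2)) ^ (((n : ℝ) - 2) / 4) * (m : ℝ) ^ ((1 : ℝ) / 2) with hL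
  have hL0 : 0 ≤ L := by positivity
  have tωs : Tendsto (fun ε => |uOne (u ε) 1| * (kappa n * ε) ^ (-(1 : ℝ) / 2)) (𝓝[>] 0)
      (𝓝 (((n : ℝ) - 2) * L)) := by
    have h := (tω2.div_const (kappa n)).sqrt
    have e : √(↑m * ((n : ℝ) - 2) ^ 2 *
        (kappa n * ((n : ℝ) * ((n : ℝ) - 2)) ^ (((n : ℝ) - 2) / 2)) / kappa n) =
        ((n : ℝ) - 2) * L := by
      rw [Real.sqrt_eq_iff_mul_self_eq (by positivity) (by positivity)]
      have e1 : (m : ℝ) ^ ((1 : ℝ) / 2) * (m : ℝ) ^ ((1 : ℝ) / 2) = m := by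
        rw [← Real.sqrt_eq_rpow, Real.mul_self_sqrt (by positivity)]
      have e2 : ((n : ℝ) * ((n : ℝ) - 2)) ^ (((n : ℝ) - 2) / 4) *
          ((n : ℝ) * ((n : ℝ) - 2)) ^ (((n : ℝ) - 2) / 4) =
          ((n : ℝ) * ((n : ℝ) - 2)) ^ (((n : ℝ) - 2) / 2) := by
        rw [← Real.rpow_add (by positivity)]; congr 1; ring
      rw [hL]
      symm
      calc _ = ((n : ℝ) - 2) ^ 2 * (((n : ℝ) * ((n : ℝ) - 2)) ^ (((n : ℝ) - 2) / 4) *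
          ((n : ℝ) * ((n : ℝ) - 2)) ^ (((n : ℝ) - 2) / 4)) *
          ((m : ℝ) ^ ((1 : ℝ) / 2) * (m : ℝ) ^ ((1 : ℝ) / 2)) := by ring
        _ = _ := by
          rw [e1, e2]; field_simp
    rw [e] at h
    refine h.congr' ?_
    filter_upwards [self_mem_nhdsWithin] with ε hε
    have hε0 : 0 < ε := hε
    rw [div_div, Real.sqrt_div (sq_nonneg _), Real.sqrt_sq_eq_abs, div_eq_mul_inv,
      Real.sqrt_eq_rpow, ← Real.rpow_neg (by positivity), mul_comm ε]
    norm_num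
  have tM : Tendsto (fun ε => K * |uOne (u ε) 1|) (𝓝[>] 0) (𝓝 0) := by
    simpa using tω.const_mul K
  constructor
  · rw [Metric.tendstoUniformlyOn_iff]
    intro e he
    have hq : (0 : ℝ) < 2 / ((n : ℝ) - 2) := hpos
    have tMq : Tendsto (fun ε => (K * |uOne (u ε) 1|) ^ (2 / ((n : ℝ) - 2))) (𝓝[>] 0) (𝓝 0) := by
      have := tM.rpow_const (p := 2 / ((n : ℝ) - 2)) (Or.inr hq.le)
      rwa [Real.zero_rpow hq.ne'] at this
    have t1 := ((tωs.const_mul K).mul tMq).const_mul (a ^ (1 - (n : ℝ)))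
    have t2 := (((tωs.div_const ((n : ℝ) - 2)).sub_const L).abs).mul_const (a ^ ((2 : ℝ) - n))
    rw [mul_div_cancel_left₀ _ hN.ne', sub_self, abs_zero, zero_mul] at t2
    have t3 := t1.add t2
    rw [mul_zero, mul_zero, zero_add] at t3
    filter_upwards [t3.eventually (gt_mem_nhds he), hbd, Ioo_mem_nhdsGT hpos,
      tM.eventually (gt_mem_nhds one_pos)] with ε b1 b2 b3 b4 r hr
    obtain ⟨q1, q2, q3, q4, q5, q6, q7, q8⟩ := params hn b3
    obtain ⟨hsol, hu1, -⟩ := hu ε q8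
    have hA := boundary_asymp hn hsol q3 hu1 ha b2 r hr
    have hr0 : 0 < r := ha.1.trans_le hr.1
    set M := K * |uOne (u ε) 1| with hM
    have hM0 : 0 ≤ M := by positivity
    set s := (kappa n * ε) ^ (-(1 : ℝ) / 2) with hs
    have hs0 : 0 ≤ s := Real.rpow_nonneg (mul_nonneg hκ.le b3.1.le) _
    have hMp : M ^ pEps n ε ≤ M * M ^ (2 / ((n : ℝ) - 2)) := by
      rcases hM0.eq_or_lt with h0 | h0
      · rw [← h0, Real.zero_rpow (by linarith)]; simp
      · rw [← Real.rpow_one_add' hM0 (by positivity)]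
        exact Real.rpow_le_rpow_of_exponent_ge h0 b4.le q1
    have hg1 : 1 ≤ r ^ ((2 : ℝ) - n) :=
      Real.one_le_rpow_of_pos_of_le_one_of_nonpos hr0 hr.2 (by linarith)
    have hg2 : r ^ ((2 : ℝ) - n) ≤ a ^ ((2 : ℝ) - n) :=
      Real.rpow_le_rpow_of_nonpos ha.1 hr.1 (by linarith)
    set G := r ^ ((2 : ℝ) - n) - 1 with hG
    have hG0 : 0 ≤ G := by linarith
    have hω : |uOne (u ε) 1 * ((1 - r ^ ((2 : ℝ) - n)) / ((n : ℝ) - 2))| =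
        |uOne (u ε) 1| / ((n : ℝ) - 2) * G := by
      rw [show 1 - r ^ ((2 : ℝ) - n) = -G by rw [hG]; ring, abs_mul, neg_div, abs_neg,
        abs_of_nonneg (div_nonneg hG0 hN.le)]
      ring
    have hdiff : |(|u ε r| - |uOne (u ε) 1| / ((n : ℝ) - 2) * G)| ≤
        a ^ (1 - (n : ℝ)) * (M * M ^ (2 / ((n : ℝ) - 2))) := by
      rw [← hω]
      refine (abs_abs_sub_abs_le_abs_sub _ _).trans (hA.trans ?_)
      exact mul_le_mul_of_nonneg_left hMp (Real.rpow_nonneg ha.1.le _)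
    rw [dist_comm, Real.dist_eq]
    refine lt_of_le_of_lt ?_ b1
    have split : |u ε r| * s - L * G =
        (|u ε r| - |uOne (u ε) 1| / ((n : ℝ) - 2) * G) * s +
          (|uOne (u ε) 1| * s / ((n : ℝ) - 2) - L) * G := by ring
    rw [split]
    refine (abs_add_le _ _).trans (add_le_add ?_ ?_)
    · rw [abs_mul, abs_of_nonneg hs0]
      refine (mul_le_mul_of_nonneg_right hdiff hs0).trans (le_of_eq ?_)
      rw [hM]; ring
    · rw [abs_mul, abs_of_nonneg hG0]
      exact mul_le_mul_of_nonneg_left (by linarith) (abs_nonneg _)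
  · rw [Metric.tendstoUniformlyOn_iff]
    intro e he
    filter_upwards [hbd, tM.eventually (gt_mem_nhds he)] with ε h1 h2 r hr
    rw [dist_comm, Real.dist_eq, sub_zero]
    exact (h1 r hr).trans_lt h2
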